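/- For every nonzero c ∈ ℂ, the image of the level-c Bargmann–Fock representation Φ_c : A → End_ℂ(ℂ[z¹,…,zⁿ]) equals the unital subalgebra of End_ℂ(ℂ[z¹,…,zⁿ]) generated by the multiplication operators s ↦ zⁱ·s and the partial derivative operators s ↦ ∂s/∂zⁱ (i = 1,…,n); i.e., Φ_c maps the level-c Wick algebra (A, ⋆_c) onto the Weyl algebra of polynomial differential operators and Φ_c(f ⋆_c g) = Φ_c(f) ∘ Φ_c(g). -/

import Mathlib

/-!
STATEMENT 11: For every nonzero c ∈ ℂ, the image of the level-c Bargmann–Fock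
representation Φ_c : A → End_ℂ(ℂ[z¹,…,zⁿ]) equals the unital subalgebra of
End_ℂ(ℂ[z¹,…,zⁿ]) generated by the multiplication operators s ↦ zⁱ·s and the
partial derivative operators s ↦ ∂s/∂zⁱ (i = 1,…,n); i.e., Φ_c maps the
level-c Wick algebra (A, ⋆_c) onto the Weyl algebra of polynomial differential
operators, and Φ_c(f ⋆_c g) = Φ_c(f) ∘ Φ_c(g).
-/

namespace Stmt11

open MvPolynomial

/-- `A = ℂ[y¹,…,yⁿ,ȳ¹,…,ȳⁿ]`; `Sum.inl i` is `yⁱ` and `Sum.inr i` is `ȳⁱ`. -/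
abbrev A (n : ℕ) : Type := MvPolynomial (Fin n ⊕ Fin n) ℂ

/-- Iterated partial derivative along a tuple of variables. -/
noncomputable def iterD {n k : ℕ} (vs : Fin k → (Fin n ⊕ Fin n)) (f : A n) : A n :=
  (List.ofFn vs).foldr (fun v acc => pderiv v acc) f

/-- The `k`-th term `(cᵏ/k!) Σ_{i₁,…,i_k} (∂ᵏf/∂y^{i₁}⋯∂y^{i_k})·(∂ᵏg/∂ȳ^{i₁}⋯∂ȳ^{i_k})`
in the level-`c` Wick product. -/
noncomputable def wickTermc {n : ℕ} (c : ℂ) (k : ℕ) (f g : A n) : A n :=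
  (c ^ k * ((k.factorial : ℂ))⁻¹) •
    ∑ t : Fin k → Fin n,
      iterD (fun j => Sum.inl (t j)) f * iterD (fun j => Sum.inr (t j)) g

/-- The level-`c` Wick product `f ⋆_c g = Σ_{k≥0} (cᵏ/k!) Σ (∂_y^k f)(∂_ȳ^k g)`;
the sum is finite since the `k`-fold derivative of `f` vanishes for
`k > totalDegree f`, so truncating at `totalDegree f + 1` loses nothing. -/
noncomputable def wickc {n : ℕ} (c : ℂ) (f g : A n) : A n :=
  ∑ k ∈ Finset.range (f.totalDegree + 1), wickTermc c k f g

/-- The total degree of `f ∈ A` in the variables `ȳ¹,…,ȳⁿ`. -/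
def degYb {n : ℕ} (f : A n) : ℕ :=
  f.support.sup fun m => ∑ i : Fin n, m (Sum.inr i)
/-- `ℂ[z¹,…,zⁿ]`. -/
abbrev Pz (n : ℕ) : Type := MvPolynomial (Fin n) ℂ

/-- The iterated partial derivative `∂^{|b|}/∂z^b` for a multi-index `b`. -/
noncomputable def dOp {n : ℕ} (b : Fin n → ℕ) : Module.End ℂ (Pz n) :=
  (List.finRange n).foldr
    (fun i L => ((pderiv i : Derivation ℂ (Pz n) (Pz n)).toLinearMap ^ b i) * L) 1

/-- The level-`c` Bargmann–Fock representation: the monomial `y^a ȳ^b` acts on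
`s` by `(−c)^{|b|} ∂^{|b|}(z^a·s)/∂z^b`, extended ℂ-linearly in `f`. -/
noncomputable def Phi {n : ℕ} (c : ℂ) (f : A n) : Module.End ℂ (Pz n) :=
  ∑ m ∈ f.support,
    (coeff m f * (-c) ^ (∑ i : Fin n, m (Sum.inr i))) •
      (dOp (fun i => m (Sum.inr i)) *
        LinearMap.mulLeft ℂ (∏ i : Fin n, (X i : Pz n) ^ m (Sum.inl i)))

/-- Partial derivatives commute. -/
theorem pd_comm {σ : Type*} (i j : σ) (p : MvPolynomial σ ℂ) :
    pderiv i (pderiv j p) = pderiv j (pderiv i p) := by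
  classical
  have h : ⁅(pderiv i : Derivation ℂ (MvPolynomial σ ℂ) (MvPolynomial σ ℂ)),
      (pderiv j : Derivation ℂ (MvPolynomial σ ℂ) (MvPolynomial σ ℂ))⁆ = 0 := by
    apply derivation_ext
    intro k
    rw [Derivation.commutator_apply, pderiv_X, pderiv_X]
    by_cases h1 : i = k <;> by_cases h2 : j = k <;> simp [Pi.single_apply, h1, h2]
  have h2 := congrArg (fun D => D p) h
  simp only [Derivation.commutator_apply, Derivation.coe_zero, Pi.zero_apply] at h2
  exact sub_eq_zero.mp h2

theorem totalDegree_pd_lt {σ : Type*} (i : σ) (f : MvPolynomial σ ℂ) (h : pderiv i f ≠ 0) :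
    (pderiv i f).totalDegree < f.totalDegree := by
  classical
  have key : ∀ m ∈ (pderiv i f).support, (m.sum fun _ e => e) < f.totalDegree := by
    intro m hm
    rw [mem_support_iff, coeff_pderiv] at hm
    have h1 : m + Finsupp.single i 1 ∈ f.support := by
      rw [mem_support_iff]
      intro h0
      exact hm (by rw [h0]; simp)
    have h2 := le_totalDegree h1
    rw [Finsupp.sum_add_index' (by simp) (by simp)] at h2
    simp at h2
    omega
  obtain ⟨m, hm⟩ := Finset.nonempty_of_ne_empty (mt support_eq_empty.mp h)
  rw [totalDegree, Finset.sup_lt_iff (lt_of_le_of_lt (Nat.zero_le _) (key m hm))]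
  exact key

/-- The sum in the k-th Wick term without its scalar. -/
noncomputable def TT {n : ℕ} (k : ℕ) (f g : A n) : A n :=
  ∑ t : Fin k → Fin n,
      iterD (fun j => Sum.inl (t j)) f * iterD (fun j => Sum.inr (t j)) g

theorem TT_zero {n : ℕ} (f g : A n) : TT 0 f g = f * g := by
  simp [TT, iterD]

theorem iterD_succ {n k : ℕ} (vs : Fin (k + 1) → (Fin n ⊕ Fin n)) (f : A n) :
    iterD vs f = iterD (fun j => vs j.castSucc) (pderiv (vs (Fin.last k)) f) := by
  unfold iterD
  rw [List.ofFn_succ']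
  simp [List.concat_eq_append, List.foldr_append]

theorem TT_succ {n : ℕ} (k : ℕ) (f g : A n) :
    TT (k + 1) f g = ∑ j : Fin n, TT k (pderiv (Sum.inl j) f) (pderiv (Sum.inr j) g) := by
  unfold TT
  rw [← (Fin.snocEquiv (fun _ : Fin (k + 1) => Fin n)).sum_comp, Fintype.sum_prod_type]
  refine Finset.sum_congr rfl fun j _ => Finset.sum_congr rfl fun t _ => ?_
  rw [iterD_succ, iterD_succ]
  simp [Fin.snocEquiv]

theorem iterD_add {n k : ℕ} (vs : Fin k → (Fin n ⊕ Fin n)) (f g : A n) :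
    iterD vs (f + g) = iterD vs f + iterD vs g := by
  induction k generalizing f g with
  | zero => simp [iterD]
  | succ k ih => rw [iterD_succ, map_add, ih, ← iterD_succ, ← iterD_succ]

theorem TT_add_left {n : ℕ} (k : ℕ) (f f' g : A n) :
    TT k (f + f') g = TT k f g + TT k f' g := by
  simp [TT, iterD_add, add_mul, Finset.sum_add_distrib]

theorem TT_add_right {n : ℕ} (k : ℕ) (f g g' : A n) :
    TT k f (g + g') = TT k f g + TT k f g' := by
  simp [TT, iterD_add, mul_add, Finset.sum_add_distrib]

theorem TT_zero_left {n : ℕ} (k : ℕ) (g : A n) : TT k 0 g = 0 := by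
  have := TT_add_left k 0 0 g
  simpa using this

theorem TT_zero_right {n : ℕ} (k : ℕ) (g : A n) : TT k g 0 = 0 := by
  have := TT_add_right k g 0 0
  simpa using this

theorem TT_vanish {n : ℕ} (k : ℕ) (f g : A n) (h : f.totalDegree < k) : TT k f g = 0 := by
  induction k generalizing f g with
  | zero => omega
  | succ k ih =>
    rw [TT_succ]
    refine Finset.sum_eq_zero fun j _ => ?_
    by_cases h0 : pderiv (Sum.inl j) f = 0
    · rw [h0, TT_zero_left]
    · have := totalDegree_pd_lt _ _ h0
      exact ih _ _ (by omega)

theorem TT_smul_right {n : ℕ} (k : ℕ) (a : ℂ) (f g : A n) :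
    TT k f (C a * g) = C a * TT k f g := by
  induction k generalizing f g with
  | zero => simp only [TT_zero]; ring
  | succ k ih =>
    simp only [TT_succ, pderiv_C_mul, ih, Finset.mul_sum]

theorem TT_one {n : ℕ} (k : ℕ) (f : A n) : TT (k + 1) f 1 = 0 := by
  simp [TT_succ, TT_zero_right]

theorem TT_y {n : ℕ} (k : ℕ) (i : Fin n) (f g : A n) :
    TT k f (X (Sum.inl i) * g) = X (Sum.inl i) * TT k f g := by
  induction k generalizing f g with
  | zero => simp only [TT_zero]; ring
  | succ k ih =>
    rw [TT_succ, TT_succ, Finset.mul_sum]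
    refine Finset.sum_congr rfl fun j _ => ?_
    rw [pderiv_mul, pderiv_X_of_ne (by simp), zero_mul, zero_add, ih]

theorem TT_yb_left {n : ℕ} (k : ℕ) (i : Fin n) (f g : A n) :
    TT k (X (Sum.inr i) * f) g = X (Sum.inr i) * TT k f g := by
  induction k generalizing f g with
  | zero => simp only [TT_zero]; ring
  | succ k ih =>
    rw [TT_succ, TT_succ, Finset.mul_sum]
    refine Finset.sum_congr rfl fun j _ => ?_
    rw [pderiv_mul, pderiv_X_of_ne (by simp), zero_mul, zero_add, ih]

theorem TT_yb {n : ℕ} (k : ℕ) (i : Fin n) (f g : A n) :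
    TT (k + 1) f (X (Sum.inr i) * g) =
      X (Sum.inr i) * TT (k + 1) f g + C ((k : ℂ) + 1) * TT k (pderiv (Sum.inl i) f) g := by
  have step : ∀ (k : ℕ) (f g : A n), TT (k + 1) f (X (Sum.inr i) * g) =
      TT k (pderiv (Sum.inl i) f) g +
      ∑ j : Fin n, TT k (pderiv (Sum.inl j) f) (X (Sum.inr i) * pderiv (Sum.inr j) g) := by
    intro k f g
    have h : ∀ j : Fin n, TT k (pderiv (Sum.inl j) f) (pderiv (Sum.inr j) (X (Sum.inr i) * g)) =
        (if j = i then TT k (pderiv (Sum.inl i) f) g else 0) +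
        TT k (pderiv (Sum.inl j) f) (X (Sum.inr i) * pderiv (Sum.inr j) g) := by
      intro j
      rw [pderiv_mul, TT_add_right]
      congr 1
      split_ifs with hj
      · subst hj; rw [pderiv_X_self, one_mul]
      · rw [pderiv_X_of_ne (by simpa using fun h => hj h.symm), zero_mul, TT_zero_right]
    rw [TT_succ, Finset.sum_congr rfl fun j _ => h j, Finset.sum_add_distrib]
    simp
  induction k generalizing f g with
  | zero =>
    rw [step]
    simp only [TT_succ, TT_zero, Finset.mul_sum]
    simp only [Nat.cast_zero, zero_add, C_1, one_mul]
    rw [add_comm]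
    congr 1
    exact Finset.sum_congr rfl fun j _ => by ring
  | succ k ih =>
    rw [step]
    simp only [ih, Finset.sum_add_distrib, ← Finset.mul_sum]
    rw [← TT_succ]
    simp only [pd_comm (Sum.inl i)]
    have h : ∑ j : Fin n, TT k (pderiv (Sum.inl i) (pderiv (Sum.inl j) f)) (pderiv (Sum.inr j) g)
        = TT (k + 1) (pderiv (Sum.inl i) f) g := by
      rw [TT_succ]
      simp only [pd_comm (Sum.inl i)]
    simp only [pd_comm (Sum.inl i)] at h
    rw [h]
    push_cast
    simp only [C_add, C_1]
    ring

/-- Truncated Wick product. -/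
noncomputable def WN {n : ℕ} (c : ℂ) (N : ℕ) (f g : A n) : A n :=
  ∑ k ∈ Finset.range N, C (c ^ k * ((k.factorial : ℂ))⁻¹) * TT k f g

theorem wickc_eq {n : ℕ} (c : ℂ) (N : ℕ) (f g : A n) (h : f.totalDegree < N) :
    wickc c f g = WN c N f g := by
  unfold wickc WN
  have h1 : ∀ k, wickTermc c k f g = C (c ^ k * ((k.factorial : ℂ))⁻¹) * TT k f g := by
    intro k
    rw [wickTermc, smul_eq_C_mul]; rfl
  simp only [h1]
  apply Finset.sum_subset
  · intro k; simp only [Finset.mem_range]; omega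
  · intro k _ hk
    simp only [Finset.mem_range] at hk
    rw [TT_vanish _ _ _ (by omega), mul_zero]

theorem WN_yb {n : ℕ} (c : ℂ) (N : ℕ) (i : Fin n) (f g : A n) :
    WN c (N + 1) f (X (Sum.inr i) * g) =
      X (Sum.inr i) * WN c (N + 1) f g + C c * WN c N (pderiv (Sum.inl i) f) g := by
  unfold WN
  rw [Finset.sum_range_succ', Finset.sum_range_succ' _ N]
  simp only [TT_yb, TT_zero, mul_add, Finset.sum_add_distrib, Finset.mul_sum]
  have h : ∀ k : ℕ, C (c ^ (k + 1) * (((k + 1).factorial : ℂ))⁻¹) *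
      (C ((k : ℂ) + 1) * TT k (pderiv (Sum.inl i) f) g) =
      C c * (C (c ^ k * ((k.factorial : ℂ))⁻¹) * TT k (pderiv (Sum.inl i) f) g) := by
    intro k
    rw [← mul_assoc, ← mul_assoc, ← C_mul, ← C_mul]
    congr 2
    have h1 : (k.factorial : ℂ) ≠ 0 := by exact_mod_cast k.factorial_ne_zero
    have h2 : (k : ℂ) + 1 ≠ 0 := by exact_mod_cast k.succ_ne_zero
    rw [Nat.factorial_succ]
    push_cast
    field_simp
    ring
  simp only [h]
  have h3 : ∀ k : ℕ, C (c ^ (k + 1) * (((k + 1).factorial : ℂ))⁻¹) *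
      (X (Sum.inr i) * TT (k + 1) f g) = X (Sum.inr i) *
      (C (c ^ (k + 1) * (((k + 1).factorial : ℂ))⁻¹) * TT (k + 1) f g) := by
    intro k; ring
  simp only [h3]
  ring

theorem wickc_yb {n : ℕ} (c : ℂ) (i : Fin n) (f g : A n) :
    wickc c f (X (Sum.inr i) * g) =
      wickc c (X (Sum.inr i) * f + C c * pderiv (Sum.inl i) f) g := by
  set f' := X (Sum.inr i) * f + C c * pderiv (Sum.inl i) f with hf'
  obtain ⟨N, h1, h2, h3⟩ : ∃ N, f.totalDegree < N ∧ f'.totalDegree < N ∧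
      (pderiv (Sum.inl i) f).totalDegree < N :=
    ⟨f.totalDegree + f'.totalDegree + (pderiv (Sum.inl i) f).totalDegree + 1,
      by omega, by omega, by omega⟩
  rw [wickc_eq c (N + 1) f _ (by omega), WN_yb, wickc_eq c (N + 1) f' _ (by omega),
    ← wickc_eq c N _ _ h3, wickc_eq c (N + 1) _ _ (by omega : _ < N + 1), hf']
  unfold WN
  have hs : ∀ k, TT k (C c * pderiv (Sum.inl i) f) g = C c * TT k (pderiv (Sum.inl i) f) g := by
    intro k
    generalize pderiv (Sum.inl i) f = p
    induction k generalizing p g with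
    | zero => simp only [TT_zero]; ring
    | succ k ih => simp only [TT_succ, pderiv_C_mul, Finset.mul_sum, ih]
  simp only [TT_add_left, TT_yb_left, hs, Finset.mul_sum, ← Finset.sum_add_distrib]
  exact Finset.sum_congr rfl fun k _ => by ring

theorem wickc_y {n : ℕ} (c : ℂ) (i : Fin n) (f g : A n) :
    wickc c f (X (Sum.inl i) * g) = X (Sum.inl i) * wickc c f g := by
  rw [wickc_eq c _ _ _ (Nat.lt_succ_self _), wickc_eq c _ _ _ (Nat.lt_succ_self _)]
  simp only [WN, TT_y, Finset.mul_sum]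
  exact Finset.sum_congr rfl fun k _ => by ring

theorem wickc_add {n : ℕ} (c : ℂ) (f g g' : A n) :
    wickc c f (g + g') = wickc c f g + wickc c f g' := by
  rw [wickc_eq c _ _ _ (Nat.lt_succ_self _), wickc_eq c _ _ _ (Nat.lt_succ_self _),
    wickc_eq c _ _ _ (Nat.lt_succ_self _)]
  simp only [WN, TT_add_right, mul_add, Finset.sum_add_distrib]

theorem wickc_C {n : ℕ} (c : ℂ) (f : A n) (a : ℂ) : wickc c f (C a) = C a * f := by
  rw [wickc_eq c _ _ _ (Nat.lt_succ_self _), WN, Finset.sum_range_succ']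
  have : ∀ k, TT (k + 1) f (C a) = 0 := by
    intro k
    have := TT_smul_right (k + 1) a f 1
    rwa [mul_one, TT_one, mul_zero] at this
  simp [this, TT_zero, mul_comm]

/-- The image of the monomial with exponent m. -/
noncomputable def PM {n : ℕ} (c : ℂ) (m : (Fin n ⊕ Fin n) →₀ ℕ) : Module.End ℂ (Pz n) :=
  ((-c) ^ (∑ i : Fin n, m (Sum.inr i))) •
      (dOp (fun i => m (Sum.inr i)) *
        LinearMap.mulLeft ℂ (∏ i : Fin n, (X i : Pz n) ^ m (Sum.inl i)))

/-- Phi as a linear map. -/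
noncomputable def PhiL {n : ℕ} (c : ℂ) : A n →ₗ[ℂ] Module.End ℂ (Pz n) :=
  (basisMonomials (Fin n ⊕ Fin n) ℂ).constr ℂ (PM c)

theorem PhiL_monomial {n : ℕ} (c : ℂ) (m : (Fin n ⊕ Fin n) →₀ ℕ) (a : ℂ) :
    PhiL c (monomial m a) = a • PM c m := by
  have h1 : (monomial m a : A n) = a • monomial m 1 := by simp [smul_monomial]
  have h2 := (basisMonomials (Fin n ⊕ Fin n) ℂ).constr_basis ℂ (PM (n := n) c) m
  rw [coe_basisMonomials] at h2
  rw [h1, map_smul, PhiL, h2]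

theorem Phi_eq {n : ℕ} (c : ℂ) (f : A n) : Phi c f = PhiL c f := by
  conv_rhs => rw [f.as_sum]
  rw [map_sum, Phi]
  refine Finset.sum_congr rfl fun m _ => ?_
  rw [PhiL_monomial, PM, smul_smul]

/-- Derivative operator. -/
noncomputable abbrev dd {n : ℕ} (i : Fin n) : Module.End ℂ (Pz n) :=
  (pderiv i : Derivation ℂ (Pz n) (Pz n)).toLinearMap

/-- Multiplication operator. -/
noncomputable abbrev zz {n : ℕ} (i : Fin n) : Module.End ℂ (Pz n) :=
  LinearMap.mulLeft ℂ (X i : Pz n)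

theorem dd_comm {n : ℕ} (i j : Fin n) : Commute (dd i) (dd j) := by
  apply LinearMap.ext
  intro p
  exact pd_comm i j p

theorem foldr_congr_aux {n : ℕ} (l : List (Fin n)) (b b' : Fin n → ℕ) (h : ∀ j ∈ l, b j = b' j) :
    l.foldr (fun i L => (dd i ^ b i) * L) 1 = l.foldr (fun i L => (dd i ^ b' i) * L) 1 := by
  induction l with
  | nil => rfl
  | cons j l ih =>
    simp only [List.foldr_cons]
    rw [ih fun k hk => h k (List.mem_cons_of_mem _ hk), h j List.mem_cons_self]

theorem foldr_succ_aux {n : ℕ} (l : List (Fin n)) (hl : l.Nodup) (i : Fin n) (hi : i ∈ l)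
    (b b' : Fin n → ℕ) (h : ∀ j, j ≠ i → b' j = b j) (h' : b' i = b i + 1) :
    l.foldr (fun i L => (dd i ^ b' i) * L) 1 =
      dd i * l.foldr (fun i L => (dd i ^ b i) * L) 1 := by
  induction l with
  | nil => simp at hi
  | cons j l ih =>
    rw [List.nodup_cons] at hl
    simp only [List.foldr_cons]
    by_cases hj : j = i
    · subst hj
      rw [h', pow_succ', mul_assoc,
        foldr_congr_aux l b' b fun k hk => h k fun e => hl.1 (e ▸ hk)]
    · rw [h j hj, ih hl.2 (by
        rcases List.mem_cons.mp hi with e | e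
        · exact absurd e.symm hj
        · exact e), ← mul_assoc, ← mul_assoc, ((dd_comm i j).pow_right (b j)).eq]

theorem PM_yb {n : ℕ} (c : ℂ) (m : (Fin n ⊕ Fin n) →₀ ℕ) (i : Fin n) :
    PM c (m + Finsupp.single (Sum.inr i) 1) = (-c) • (dd i * PM c m) := by
  classical
  unfold PM
  have h1 : dOp (fun j => (m + Finsupp.single (Sum.inr i) 1 : (Fin n ⊕ Fin n) →₀ ℕ) (Sum.inr j)) =
      dd i * dOp (fun j => m (Sum.inr j)) := by
    unfold dOp
    refine foldr_succ_aux _ (List.nodup_finRange n) i (List.mem_finRange i) _ _ ?_ ?_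
    · intro j hj
      simp [Finsupp.single_apply, Ne.symm hj]
    · simp
  have h2 : ∑ j : Fin n, (m + Finsupp.single (Sum.inr i) 1 : (Fin n ⊕ Fin n) →₀ ℕ) (Sum.inr j) =
      (∑ j : Fin n, m (Sum.inr j)) + 1 := by
    simp [Finset.sum_add_distrib, Finsupp.single_apply]
  rw [h1, h2]
  simp only [Finsupp.add_apply, Finsupp.single_apply, reduceCtorEq, if_false, add_zero]
  rw [mul_smul_comm, smul_smul, pow_succ', mul_assoc]

theorem PM_y {n : ℕ} (c : ℂ) (m : (Fin n ⊕ Fin n) →₀ ℕ) (i : Fin n) :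
    PM c (m + Finsupp.single (Sum.inl i) 1) = PM c m * zz i := by
  classical
  unfold PM
  have h2 : ∏ j : Fin n, (X j : Pz n) ^
      (m + Finsupp.single (Sum.inl i) 1 : (Fin n ⊕ Fin n) →₀ ℕ) (Sum.inl j) =
      (∏ j : Fin n, (X j : Pz n) ^ m (Sum.inl j)) * X i := by
    simp only [Finsupp.add_apply, pow_add, Finset.prod_mul_distrib]
    congr 1
    simp [Finsupp.single_apply, pow_ite]
  rw [h2, LinearMap.mulLeft_mul]
  simp only [Finsupp.add_apply, Finsupp.single_apply, reduceCtorEq, if_false, add_zero]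
  rw [smul_mul_assoc, mul_assoc]
  rfl

theorem PhiL_yb {n : ℕ} (c : ℂ) (i : Fin n) (f : A n) :
    PhiL c (X (Sum.inr i) * f) = (-c) • (dd i * PhiL c f) := by
  induction f using MvPolynomial.induction_on' with
  | monomial m a =>
    rw [mul_comm, X, monomial_mul, PhiL_monomial, PhiL_monomial, PM_yb, mul_one, mul_smul_comm,
      smul_comm]
  | add p q hp hq => rw [mul_add, map_add, map_add, hp, hq, mul_add, smul_add]

theorem PhiL_y {n : ℕ} (c : ℂ) (i : Fin n) (f : A n) :
    PhiL c (X (Sum.inl i) * f) = PhiL c f * zz i := by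
  induction f using MvPolynomial.induction_on' with
  | monomial m a =>
    rw [mul_comm, X, monomial_mul, PhiL_monomial, PhiL_monomial, PM_y, mul_one, smul_mul_assoc]
  | add p q hp hq => rw [mul_add, map_add, map_add, hp, hq, add_mul]

theorem PhiL_one {n : ℕ} (c : ℂ) : PhiL c (1 : A n) = 1 := by
  have h : (1 : A n) = monomial 0 1 := rfl
  rw [h, PhiL_monomial, PM]
  have h1 : ∀ l : List (Fin n), l.foldr (fun i L => (dd i ^ 0) * L) 1 = 1 := by
    intro l
    induction l with
    | nil => rfl
    | cons j l ih => rw [List.foldr_cons, ih, pow_zero, mul_one]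
  have h2 : dOp (fun i : Fin n => (0 : (Fin n ⊕ Fin n) →₀ ℕ) (Sum.inr i)) = 1 := h1 _
  rw [h2]
  simp
  rfl

theorem PhiL_C {n : ℕ} (c a : ℂ) : PhiL c (C a : A n) = a • 1 := by
  have h : (C a : A n) = a • 1 := by rw [smul_eq_C_mul, mul_one]
  rw [h, map_smul, PhiL_one]

theorem PhiL_C_mul {n : ℕ} (c a : ℂ) (f : A n) : PhiL c (C a * f : A n) = a • PhiL c f := by
  rw [← smul_eq_C_mul, map_smul]

theorem zz_dd {n : ℕ} (i j : Fin n) :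
    zz j * dd i = dd i * zz j - (if j = i then 1 else 0) := by
  classical
  apply LinearMap.ext
  intro p
  have h : (dd i * zz j) p = pderiv i (X j * p) := rfl
  have h' : (zz j * dd i) p = X j * pderiv i p := rfl
  rw [LinearMap.sub_apply, h, h', pderiv_mul]
  split_ifs with hj
  · subst hj; simp
  · rw [pderiv_X_of_ne hj]; simp

theorem PhiL_dd {n : ℕ} (c : ℂ) (i : Fin n) (f : A n) :
    (-c) • (PhiL c f * dd i) = PhiL c (X (Sum.inr i) * f + C c * pderiv (Sum.inl i) f) := by
  rw [map_add, PhiL_C_mul, PhiL_yb]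
  induction f using MvPolynomial.induction_on with
  | C a => simp [PhiL_C]
  | add p q hp hq =>
    simp only [map_add, add_mul, mul_add, smul_add, hp, hq]
    abel
  | mul_X p v hp =>
    rw [mul_comm p, pderiv_mul, map_add]
    rcases v with j | j
    · rw [PhiL_y, PhiL_y, mul_assoc, zz_dd, mul_sub, smul_sub, ← mul_assoc, ← smul_mul_assoc, hp]
      by_cases hj : j = i
      · subst hj
        simp only [if_true, pderiv_X_self, one_mul, mul_one, add_mul, smul_mul_assoc, mul_assoc,
          smul_add, neg_smul]
        abel
      · rw [pderiv_X_of_ne (by simpa using hj)]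
        simp only [hj, if_false, mul_zero, zero_mul, map_zero, smul_zero, sub_zero, zero_add,
          add_mul, smul_mul_assoc, mul_assoc]
    · rw [PhiL_yb, PhiL_yb, pderiv_X_of_ne (by simp), zero_mul, map_zero, zero_add,
        smul_mul_assoc, mul_assoc, ← mul_smul_comm, hp, mul_add, smul_add]
      simp only [mul_smul_comm, smul_smul]
      rw [← mul_assoc, ← mul_assoc, (dd_comm j i).eq, mul_comm c (-c)]

theorem PhiL_wick {n : ℕ} (c : ℂ) (f g : A n) :
    PhiL c (wickc c f g) = PhiL c f * PhiL c g := by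
  induction g using MvPolynomial.induction_on generalizing f with
  | C a => rw [wickc_C, PhiL_C_mul, PhiL_C, mul_smul_comm, mul_one]
  | add p q hp hq => rw [wickc_add, map_add, map_add, mul_add, hp, hq]
  | mul_X p v hp =>
    rw [mul_comm p]
    rcases v with j | j
    · rw [wickc_y, PhiL_y, PhiL_y, hp, mul_assoc]
    · rw [wickc_yb, hp, ← PhiL_dd, PhiL_yb, mul_smul_comm, smul_mul_assoc, mul_assoc]

theorem PM_mem {n : ℕ} (c : ℂ) (S : Subalgebra ℂ (Module.End ℂ (Pz n)))
    (hz : ∀ i, zz i ∈ S) (hd : ∀ i, dd i ∈ S) (f : A n) : PhiL c f ∈ S := by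
  induction f using MvPolynomial.induction_on with
  | C a => rw [PhiL_C]; exact S.smul_mem S.one_mem a
  | add p q hp hq => rw [map_add]; exact S.add_mem hp hq
  | mul_X p v hp =>
    rw [mul_comm p]
    rcases v with j | j
    · rw [PhiL_y]; exact S.mul_mem hp (hz j)
    · rw [PhiL_yb]; exact S.smul_mem (S.mul_mem (hd j) hp) _

theorem bargmann_fock_image_weyl_algebra (n : ℕ) (hn : 1 ≤ n) (c : ℂ) (hc : c ≠ 0) :
    Set.range (Phi (n := n) c) =
      (Algebra.adjoin ℂ
        ((Set.range fun i : Fin n => LinearMap.mulLeft ℂ (X i : Pz n)) ∪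
          (Set.range fun i : Fin n =>
            (pderiv i : Derivation ℂ (Pz n) (Pz n)).toLinearMap)) :
        Subalgebra ℂ (Module.End ℂ (Pz n))) ∧
    ∀ f g : A n, Phi c (wickc c f g) = Phi c f * Phi c g := by
  refine ⟨?_, fun f g => by rw [Phi_eq, Phi_eq, Phi_eq, PhiL_wick]⟩
  apply Set.Subset.antisymm
  · rintro _ ⟨f, rfl⟩
    rw [Phi_eq]
    exact PM_mem c _ (fun i => Algebra.subset_adjoin (Or.inl ⟨i, rfl⟩))
      (fun i => Algebra.subset_adjoin (Or.inr ⟨i, rfl⟩)) f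
  · intro T hT
    suffices h : ∃ f, PhiL c f = T by
      obtain ⟨f, hf⟩ := h
      exact ⟨f, by rw [Phi_eq, hf]⟩
    refine Algebra.adjoin_induction (p := fun T _ => ∃ f, PhiL c f = T) ?_ ?_ ?_ ?_ hT
    · rintro _ (⟨i, rfl⟩ | ⟨i, rfl⟩)
      · exact ⟨X (Sum.inl i) * 1, by rw [PhiL_y, PhiL_one, one_mul]⟩
      · refine ⟨C (-c)⁻¹ * (X (Sum.inr i) * 1), ?_⟩
        rw [PhiL_C_mul, PhiL_yb, PhiL_one, mul_one, smul_smul,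
          inv_mul_cancel₀ (neg_ne_zero.mpr hc), one_smul]
    · intro a
      exact ⟨C a, by rw [PhiL_C, Algebra.algebraMap_eq_smul_one]⟩
    · rintro _ _ _ _ ⟨f, rfl⟩ ⟨g, rfl⟩
      exact ⟨f + g, map_add _ _ _⟩
    · rintro _ _ _ _ ⟨f, rfl⟩ ⟨g, rfl⟩
      exact ⟨wickc c f g, PhiL_wick c f g⟩

end Stmt11
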